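/- Let m ≥ 1 be an integer. For every ε > 0 there exists a constant c > 0, depending only on m and ε, such that for every smooth periodic function u : ℝ² → ℝ, ‖A^{m+1}u‖ · ‖A^{m−1}(|∇u|²)‖ ≤ ε ‖A^{m+1}u‖² + c(‖u‖^{2(2m+3)} + 1). -/

import Mathlib

open MeasureTheory Real Filter

noncomputable section

/-- A function `u : ℝ² → ℝ` is smooth periodic if it is `C^∞` and `2π`-periodic
in each variable. -/
def SmoothPeriodic (u : ℝ × ℝ → ℝ) : Prop :=
  ContDiff ℝ (⊤ : ℕ∞) u ∧ (∀ x y, u (x + 2 * Real.pi, y) = u (x, y)) ∧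
    (∀ x y, u (x, y + 2 * Real.pi) = u (x, y))

/-- Partial derivative in the first variable. -/
def pdx (u : ℝ × ℝ → ℝ) : ℝ × ℝ → ℝ := fun p => fderiv ℝ u p (1, 0)

/-- Partial derivative in the second variable. -/
def pdy (u : ℝ × ℝ → ℝ) : ℝ × ℝ → ℝ := fun p => fderiv ℝ u p (0, 1)

/-- The fundamental domain `[0, 2π]²`. -/
def sq2 : Set (ℝ × ℝ) := Set.Icc (0 : ℝ) (2 * Real.pi) ×ˢ Set.Icc (0 : ℝ) (2 * Real.pi)

/-- The `L²` inner product over `[0, 2π]²`. -/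
def l2inner (u v : ℝ × ℝ → ℝ) : ℝ := ∫ p in sq2, u p * v p

/-- The `L²` norm over `[0, 2π]²`. -/
def l2norm (u : ℝ × ℝ → ℝ) : ℝ := Real.sqrt (∫ p in sq2, (u p) ^ 2)

/-- The `L^q` norm over `[0, 2π]²`. -/
def lpnorm (q : ℝ) (u : ℝ × ℝ → ℝ) : ℝ := (∫ p in sq2, |u p| ^ q) ^ (1 / q)

/-- The operator `A = -Δ + 1`. -/
def Aop (u : ℝ × ℝ → ℝ) : ℝ × ℝ → ℝ :=
  fun p => -(pdx (pdx u) p + pdy (pdy u) p) + u p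

/-- The pointwise dot product of gradients, `∇v ⋅ ∇w`. -/
def gradDot (v w : ℝ × ℝ → ℝ) : ℝ × ℝ → ℝ :=
  fun p => pdx v p * pdx w p + pdy v p * pdy w p

/-- The nonlinearity `f(u) = (a+3)u − 4Au + b|∇u|² + u³`. -/
def fNL (a b : ℝ) (u : ℝ × ℝ → ℝ) : ℝ × ℝ → ℝ :=
  fun p => (a + 3) * u p - 4 * Aop u p + b * gradDot u u p + (u p) ^ 3

/-- The derivative of `u` in the direction `e`. -/
def pd (e : ℝ × ℝ) (u : ℝ × ℝ → ℝ) : ℝ × ℝ → ℝ := fun p => fderiv ℝ u p e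

theorem pdx_eq_pd (u : ℝ × ℝ → ℝ) : pdx u = pd (1, 0) u := rfl

theorem pdy_eq_pd (u : ℝ × ℝ → ℝ) : pdy u = pd (0, 1) u := rfl

theorem Aop_eq (u : ℝ × ℝ → ℝ) :
    Aop u = (-1 : ℝ) • pd (1, 0) (pd (1, 0) u) + (-1 : ℝ) • pd (0, 1) (pd (0, 1) u) + u := by
  funext p
  simp only [Aop, pdx_eq_pd, pdy_eq_pd, Pi.add_apply, Pi.smul_apply, smul_eq_mul]
  ring

namespace SmoothPeriodic

variable {u v : ℝ × ℝ → ℝ}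

theorem continuous (hu : SmoothPeriodic u) : Continuous u := hu.1.continuous

theorem differentiable (hu : SmoothPeriodic u) : Differentiable ℝ u :=
  hu.1.differentiable (by simp)

theorem add (hu : SmoothPeriodic u) (hv : SmoothPeriodic v) : SmoothPeriodic (u + v) :=
  ⟨hu.1.add hv.1, fun x y => by simp [hu.2.1 x y, hv.2.1 x y],
    fun x y => by simp [hu.2.2 x y, hv.2.2 x y]⟩

theorem mul (hu : SmoothPeriodic u) (hv : SmoothPeriodic v) : SmoothPeriodic (u * v) :=
  ⟨hu.1.mul hv.1, fun x y => by simp [hu.2.1 x y, hv.2.1 x y],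
    fun x y => by simp [hu.2.2 x y, hv.2.2 x y]⟩

theorem smul (c : ℝ) (hu : SmoothPeriodic u) : SmoothPeriodic (c • u) :=
  ⟨hu.1.const_smul c, fun x y => by simp [hu.2.1 x y], fun x y => by simp [hu.2.2 x y]⟩

theorem pd (e : ℝ × ℝ) (hu : SmoothPeriodic u) : SmoothPeriodic (pd e u) := by
  refine ⟨(hu.1.fderiv_right (m := (⊤ : ℕ∞)) (by simp)).clm_apply contDiff_const, ?_, ?_⟩
  · intro x y
    have h : (fun p => u (p + (2 * Real.pi, 0))) = u := by
      funext p
      exact (congrArg u (by simp [Prod.ext_iff])).trans (hu.2.1 p.1 p.2)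
    have h2 := fderiv_comp_add_right (𝕜 := ℝ) (f := u) (x := (x, y)) (2 * Real.pi, 0)
    rw [h] at h2
    simp only [_root_.pd, h2, Prod.mk_add_mk, add_zero]
  · intro x y
    have h : (fun p => u (p + (0, 2 * Real.pi))) = u := by
      funext p
      exact (congrArg u (by simp [Prod.ext_iff])).trans (hu.2.2 p.1 p.2)
    have h2 := fderiv_comp_add_right (𝕜 := ℝ) (f := u) (x := (x, y)) (0, 2 * Real.pi)
    rw [h] at h2
    simp only [_root_.pd, h2, Prod.mk_add_mk, add_zero]

theorem Aop (hu : SmoothPeriodic u) : SmoothPeriodic (Aop u) := by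
  rw [Aop_eq]
  exact ((((hu.pd _).pd _).smul _).add (((hu.pd _).pd _).smul _)).add hu

theorem iterate_Aop (hu : SmoothPeriodic u) (n : ℕ) : SmoothPeriodic (_root_.Aop^[n] u) := by
  induction n generalizing u with
  | zero => exact hu
  | succ n ih => exact ih hu.Aop

theorem pd_comm (hu : SmoothPeriodic u) (e e' : ℝ × ℝ) :
    _root_.pd e (_root_.pd e' u) = _root_.pd e' (_root_.pd e u) := by
  funext p
  have hd : DifferentiableAt ℝ (fderiv ℝ u) p :=
    (hu.1.fderiv_right (m := (⊤ : ℕ∞)) (by simp)).differentiable (by simp) p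
  have hs : IsSymmSndFDerivAt ℝ u p := hu.1.contDiffAt.isSymmSndFDerivAt (by
    rw [minSmoothness_of_isRCLikeNormedField]
    exact WithTop.coe_le_coe.2 (le_top (a := (2 : ℕ∞))))
  have key (a b : ℝ × ℝ) : _root_.pd a (_root_.pd b u) p = fderiv ℝ (fderiv ℝ u) p a b := by
    have h := (hd.hasFDerivAt.clm_apply (hasFDerivAt_const b p)).fderiv
    change fderiv ℝ (fun p => fderiv ℝ u p b) p a = _
    rw [h]
    simp
  rw [key, key]
  exact hs.eq e e'

theorem pd_add (hu : SmoothPeriodic u) (hv : SmoothPeriodic v) (e : ℝ × ℝ) :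
    _root_.pd e (u + v) = _root_.pd e u + _root_.pd e v := by
  funext p
  simp [_root_.pd, fderiv_add (hu.differentiable p) (hv.differentiable p)]

theorem pd_smul (hu : SmoothPeriodic u) (c : ℝ) (e : ℝ × ℝ) :
    _root_.pd e (c • u) = c • _root_.pd e u := by
  funext p
  simp [_root_.pd, fderiv_const_smul (hu.differentiable p)]

theorem pd_mul (hu : SmoothPeriodic u) (hv : SmoothPeriodic v) (e : ℝ × ℝ) :
    _root_.pd e (u * v) = _root_.pd e u * v + u * _root_.pd e v := by
  funext p
  simp [_root_.pd, fderiv_mul (hu.differentiable p) (hv.differentiable p)]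
  ring

theorem Aop_add (hu : SmoothPeriodic u) (hv : SmoothPeriodic v) :
    _root_.Aop (u + v) = _root_.Aop u + _root_.Aop v := by
  simp only [Aop_eq, hu.pd_add hv, (hu.pd _).pd_add (hv.pd _), smul_add]
  abel

theorem Aop_smul (hu : SmoothPeriodic u) (c : ℝ) : _root_.Aop (c • u) = c • _root_.Aop u := by
  simp only [Aop_eq, hu.pd_smul, (hu.pd _).pd_smul, smul_add, smul_comm c]

theorem iterate_Aop_add (hu : SmoothPeriodic u) (hv : SmoothPeriodic v) (n : ℕ) :
    _root_.Aop^[n] (u + v) = _root_.Aop^[n] u + _root_.Aop^[n] v := by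
  induction n generalizing u v with
  | zero => rfl
  | succ n ih => simp only [Function.iterate_succ_apply, hu.Aop_add hv, ih hu.Aop hv.Aop]

theorem iterate_Aop_smul (hu : SmoothPeriodic u) (c : ℝ) (n : ℕ) :
    _root_.Aop^[n] (c • u) = c • _root_.Aop^[n] u := by
  induction n generalizing u with
  | zero => rfl
  | succ n ih => simp only [Function.iterate_succ_apply, hu.Aop_smul, ih hu.Aop]

/-- The Leibniz rule for `A`. -/
theorem Aop_mul (hu : SmoothPeriodic u) (hv : SmoothPeriodic v) :
    _root_.Aop (u * v) =
      (-1 : ℝ) • (_root_.pd (1, 0) (_root_.pd (1, 0) u) * v) +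
      (-1 : ℝ) • (u * _root_.pd (1, 0) (_root_.pd (1, 0) v)) +
      (-2 : ℝ) • (_root_.pd (1, 0) u * _root_.pd (1, 0) v) +
      (-1 : ℝ) • (_root_.pd (0, 1) (_root_.pd (0, 1) u) * v) +
      (-1 : ℝ) • (u * _root_.pd (0, 1) (_root_.pd (0, 1) v)) +
      (-2 : ℝ) • (_root_.pd (0, 1) u * _root_.pd (0, 1) v) + u * v := by
  simp only [Aop_eq, hu.pd_mul hv, ((hu.pd _).mul hv).pd_add (hu.mul (hv.pd _)),
    (hu.pd _).pd_mul hv, hu.pd_mul (hv.pd _)]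
  funext p
  simp only [Pi.add_apply, Pi.smul_apply, Pi.mul_apply, smul_eq_mul]
  ring

theorem hasDerivAt_fst (hu : SmoothPeriodic u) (x y : ℝ) :
    HasDerivAt (fun t => u (t, y)) (_root_.pd (1, 0) u (x, y)) x :=
  (hu.differentiable (x, y)).hasFDerivAt.comp_hasDerivAt x
    ((hasDerivAt_id x).prodMk (hasDerivAt_const x y))

theorem hasDerivAt_snd (hu : SmoothPeriodic u) (x y : ℝ) :
    HasDerivAt (fun t => u (x, t)) (_root_.pd (0, 1) u (x, y)) y :=
  (hu.differentiable (x, y)).hasFDerivAt.comp_hasDerivAt y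
    ((hasDerivAt_const y x).prodMk (hasDerivAt_id y))

end SmoothPeriodic

theorem integrableOn_sq2 {f : ℝ × ℝ → ℝ} (hf : Continuous f) : IntegrableOn f sq2 :=
  hf.continuousOn.integrableOn_compact (isCompact_Icc.prod isCompact_Icc)

theorem measurableSet_sq2 : MeasurableSet sq2 := measurableSet_Icc.prod measurableSet_Icc

theorem setIntegral_Icc_two_pi (f : ℝ → ℝ) :
    ∫ t in Set.Icc 0 (2 * Real.pi), f t = ∫ t in (0 : ℝ)..(2 * Real.pi), f t := by
  rw [integral_Icc_eq_integral_Ioc, intervalIntegral.integral_of_le Real.two_pi_pos.le]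

theorem setIntegral_sq2_eq {f : ℝ × ℝ → ℝ} (hf : Continuous f) :
    ∫ p in sq2, f p =
      ∫ x in Set.Icc 0 (2 * Real.pi), ∫ y in (0 : ℝ)..(2 * Real.pi), f (x, y) := by
  have h := integrableOn_sq2 hf
  rw [sq2, Measure.volume_eq_prod] at *
  rw [setIntegral_prod _ h]
  simp only [setIntegral_Icc_two_pi]

theorem setIntegral_sq2_eq_symm {f : ℝ × ℝ → ℝ} (hf : Continuous f) :
    ∫ p in sq2, f p =
      ∫ y in Set.Icc 0 (2 * Real.pi), ∫ x in (0 : ℝ)..(2 * Real.pi), f (x, y) := by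
  have h := integrableOn_sq2 hf
  rw [sq2, Measure.volume_eq_prod] at *
  rw [IntegrableOn, ← Measure.prod_restrict] at h
  rw [← Measure.prod_restrict, integral_prod_symm _ h]
  simp only [setIntegral_Icc_two_pi]

theorem setIntegral_pd_fst {u : ℝ × ℝ → ℝ} (hu : SmoothPeriodic u) :
    ∫ p in sq2, pd (1, 0) u p = 0 := by
  rw [setIntegral_sq2_eq_symm (hu.pd _).continuous]
  refine integral_eq_zero_of_ae (Eventually.of_forall fun y => ?_)
  have hc : Continuous fun x => pd (1, 0) u (x, y) := (hu.pd _).continuous.comp (by fun_prop)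
  simp only [Pi.zero_apply]
  rw [intervalIntegral.integral_eq_sub_of_hasDerivAt (fun x _ => hu.hasDerivAt_fst x y)
    (hc.intervalIntegrable _ _)]
  simpa [sub_eq_zero] using hu.2.1 0 y

theorem setIntegral_pd_snd {u : ℝ × ℝ → ℝ} (hu : SmoothPeriodic u) :
    ∫ p in sq2, pd (0, 1) u p = 0 := by
  rw [setIntegral_sq2_eq (hu.pd _).continuous]
  refine integral_eq_zero_of_ae (Eventually.of_forall fun x => ?_)
  have hc : Continuous fun y => pd (0, 1) u (x, y) := (hu.pd _).continuous.comp (by fun_prop)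
  simp only [Pi.zero_apply]
  rw [intervalIntegral.integral_eq_sub_of_hasDerivAt (fun y _ => hu.hasDerivAt_snd x y)
    (hc.intervalIntegrable _ _)]
  simpa [sub_eq_zero] using hu.2.2 x 0

/-! ### The `L²` inner product -/

section L2

variable {f g h : ℝ × ℝ → ℝ}

theorem l2inner_comm (f g : ℝ × ℝ → ℝ) : l2inner f g = l2inner g f := by
  simp only [l2inner, mul_comm]

theorem l2inner_self_nonneg (f : ℝ × ℝ → ℝ) : 0 ≤ l2inner f f :=
  integral_nonneg fun p => mul_self_nonneg (f p)

theorem l2inner_add_left (hf : Continuous f) (hg : Continuous g) (hh : Continuous h) :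
    l2inner (f + g) h = l2inner f h + l2inner g h := by
  simp only [l2inner, Pi.add_apply, add_mul]
  exact integral_add (integrableOn_sq2 (hf.mul hh)) (integrableOn_sq2 (hg.mul hh))

theorem l2inner_smul_left (c : ℝ) (f g : ℝ × ℝ → ℝ) :
    l2inner (c • f) g = c * l2inner f g := by
  simp only [l2inner, Pi.smul_apply, smul_eq_mul, mul_assoc]
  exact integral_const_mul c _

theorem l2norm_sq (f : ℝ × ℝ → ℝ) : l2norm f ^ 2 = l2inner f f := by
  simp only [l2norm, l2inner, ← pow_two]
  exact Real.sq_sqrt (integral_nonneg fun p => sq_nonneg (f p))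

theorem l2norm_nonneg (f : ℝ × ℝ → ℝ) : 0 ≤ l2norm f := Real.sqrt_nonneg _

/-- The Cauchy–Schwarz inequality, from nonnegativity of the quadratic polynomial
`t ↦ a t² + 2 b t + c`. -/
theorem sq_le_mul_of_quadratic_nonneg {a b c : ℝ} (h : ∀ t : ℝ, 0 ≤ a * t ^ 2 + 2 * b * t + c) :
    b ^ 2 ≤ a * c := by
  have h1 := discrim_le_zero (a := a) (b := 2 * b) (c := c) fun t => by
    simpa only [pow_two] using h t
  rw [discrim] at h1
  linarith

theorem l2inner_sq_le (hf : Continuous f) (hg : Continuous g) :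
    l2inner f g ^ 2 ≤ l2inner f f * l2inner g g := by
  refine sq_le_mul_of_quadratic_nonneg fun t => ?_
  have h := l2inner_self_nonneg (t • f + g)
  have htf : Continuous (t • f) := hf.const_smul t
  rw [l2inner_add_left htf hg (htf.add hg), l2inner_smul_left, l2inner_comm f, l2inner_comm g,
    l2inner_add_left htf hg hf, l2inner_add_left htf hg hg, l2inner_smul_left, l2inner_smul_left,
    l2inner_comm g f] at h
  linarith

theorem l2norm_add_le (hf : Continuous f) (hg : Continuous g) :
    l2norm (f + g) ≤ l2norm f + l2norm g := by
  have h1 : l2inner f g ≤ l2norm f * l2norm g := by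
    refine le_of_sq_le_sq ?_ (mul_nonneg (l2norm_nonneg f) (l2norm_nonneg g))
    rw [mul_pow, l2norm_sq, l2norm_sq]
    exact l2inner_sq_le hf hg
  refine le_of_sq_le_sq ?_ (add_nonneg (l2norm_nonneg f) (l2norm_nonneg g))
  rw [l2norm_sq, l2inner_add_left hf hg (hf.add hg), l2inner_comm f, l2inner_comm g,
    l2inner_add_left hf hg hf, l2inner_add_left hf hg hg, l2inner_comm g f, add_sq,
    l2norm_sq, l2norm_sq]
  linarith

theorem l2norm_smul (c : ℝ) (f : ℝ × ℝ → ℝ) : l2norm (c • f) = |c| * l2norm f := by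
  rw [← abs_of_nonneg (l2norm_nonneg (c • f)), ← abs_of_nonneg (l2norm_nonneg f), ← abs_mul,
    ← sq_eq_sq_iff_abs_eq_abs, mul_pow, l2norm_sq, l2norm_sq, l2inner_smul_left, l2inner_comm,
    l2inner_smul_left]
  ring

theorem l2inner_pd_left {e : ℝ × ℝ}
    (he : ∀ u : ℝ × ℝ → ℝ, SmoothPeriodic u → ∫ p in sq2, pd e u p = 0)
    (hf : SmoothPeriodic f) (hg : SmoothPeriodic g) :
    l2inner (pd e f) g = -l2inner f (pd e g) := by
  have h := he _ (hf.mul hg)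
  rw [hf.pd_mul hg] at h
  rw [integral_add' (integrableOn_sq2 ((hf.pd e).mul hg).continuous)
    (integrableOn_sq2 (hf.mul (hg.pd e)).continuous)] at h
  exact eq_neg_of_add_eq_zero_left h

end L2

/-! ### The Sobolev inner products `⟨A^k u, v⟩` -/

/-- The inner product `⟨A^k u, v⟩`, written symmetrically in terms of derivatives. -/
def sobolevInner : ℕ → (ℝ × ℝ → ℝ) → (ℝ × ℝ → ℝ) → ℝ
  | 0, u, v => l2inner u v
  | k + 1, u, v => sobolevInner k (pd (1, 0) u) (pd (1, 0) v) +
      sobolevInner k (pd (0, 1) u) (pd (0, 1) v) + sobolevInner k u v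

section Sobolev

variable {u v w : ℝ × ℝ → ℝ}

theorem sobolevInner_comm (k : ℕ) (u v : ℝ × ℝ → ℝ) :
    sobolevInner k u v = sobolevInner k v u := by
  induction k generalizing u v with
  | zero => exact l2inner_comm u v
  | succ k ih => simp only [sobolevInner, ih _ (pd _ v), ih u v]

theorem sobolevInner_self_nonneg (k : ℕ) (u : ℝ × ℝ → ℝ) : 0 ≤ sobolevInner k u u := by
  induction k generalizing u with
  | zero => exact l2inner_self_nonneg u
  | succ k ih => exact add_nonneg (add_nonneg (ih _) (ih _)) (ih _)

theorem sobolevInner_self_le_succ (k : ℕ) (u : ℝ × ℝ → ℝ) :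
    sobolevInner k u u ≤ sobolevInner (k + 1) u u :=
  le_add_of_nonneg_left
    (add_nonneg (sobolevInner_self_nonneg _ _) (sobolevInner_self_nonneg _ _))

theorem sobolevInner_pd_fst_le (k : ℕ) (u : ℝ × ℝ → ℝ) :
    sobolevInner k (pd (1, 0) u) (pd (1, 0) u) ≤ sobolevInner (k + 1) u u := by
  rw [sobolevInner]
  linarith [sobolevInner_self_nonneg k u, sobolevInner_self_nonneg k (pd (0, 1) u)]

theorem sobolevInner_pd_snd_le (k : ℕ) (u : ℝ × ℝ → ℝ) :
    sobolevInner k (pd (0, 1) u) (pd (0, 1) u) ≤ sobolevInner (k + 1) u u := by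
  rw [sobolevInner]
  linarith [sobolevInner_self_nonneg k u, sobolevInner_self_nonneg k (pd (1, 0) u)]

theorem sobolevInner_add_left (k : ℕ) (hu : SmoothPeriodic u) (hv : SmoothPeriodic v)
    (hw : SmoothPeriodic w) :
    sobolevInner k (u + v) w = sobolevInner k u w + sobolevInner k v w := by
  induction k generalizing u v w with
  | zero => exact l2inner_add_left hu.continuous hv.continuous hw.continuous
  | succ k ih =>
    simp only [sobolevInner, hu.pd_add hv, ih hu hv hw, ih (hu.pd _) (hv.pd _) (hw.pd _)]
    ring

theorem sobolevInner_smul_left (k : ℕ) (c : ℝ) (hu : SmoothPeriodic u) (v : ℝ × ℝ → ℝ) :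
    sobolevInner k (c • u) v = c * sobolevInner k u v := by
  induction k generalizing u v with
  | zero => exact l2inner_smul_left c u v
  | succ k ih =>
    simp only [sobolevInner, hu.pd_smul, ih hu, ih (hu.pd _)]
    ring

theorem sobolevInner_sq_le (k : ℕ) (hu : SmoothPeriodic u) (hv : SmoothPeriodic v) :
    sobolevInner k u v ^ 2 ≤ sobolevInner k u u * sobolevInner k v v := by
  refine sq_le_mul_of_quadratic_nonneg fun t => ?_
  have h := sobolevInner_self_nonneg k (t • u + v)
  have hs : SmoothPeriodic (t • u) := hu.smul t
  rw [sobolevInner_add_left k hs hv (hs.add hv), sobolevInner_smul_left k t hu,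
    sobolevInner_comm k u, sobolevInner_comm k v, sobolevInner_add_left k hs hv hu,
    sobolevInner_add_left k hs hv hv, sobolevInner_smul_left k t hu,
    sobolevInner_smul_left k t hu, sobolevInner_comm k v u] at h
  linarith

theorem sobolevInner_pd_left {e : ℝ × ℝ}
    (he : ∀ u : ℝ × ℝ → ℝ, SmoothPeriodic u → ∫ p in sq2, pd e u p = 0) (k : ℕ)
    (hu : SmoothPeriodic u) (hv : SmoothPeriodic v) :
    sobolevInner k (pd e u) v = -sobolevInner k u (pd e v) := by
  induction k generalizing u v with
  | zero => exact l2inner_pd_left he hu hv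
  | succ k ih =>
    simp only [sobolevInner, hu.pd_comm _ e, hv.pd_comm _ e, ih hu hv, ih (hu.pd _) (hv.pd _)]
    ring

theorem sobolevInner_Aop_left (k : ℕ) (hu : SmoothPeriodic u) (hv : SmoothPeriodic v) :
    sobolevInner k (Aop u) v = sobolevInner (k + 1) u v := by
  have hx := (hu.pd (1, 0)).pd (1, 0)
  have hy := (hu.pd (0, 1)).pd (0, 1)
  rw [Aop_eq, sobolevInner_add_left k ((hx.smul _).add (hy.smul _)) hu hv,
    sobolevInner_add_left k (hx.smul _) (hy.smul _) hv, sobolevInner_smul_left k _ hx,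
    sobolevInner_smul_left k _ hy,
    sobolevInner_pd_left (fun _ h => setIntegral_pd_fst h) k (hu.pd _) hv,
    sobolevInner_pd_left (fun _ h => setIntegral_pd_snd h) k (hu.pd _) hv, sobolevInner]
  ring

theorem sobolevInner_Aop_Aop (k : ℕ) (hu : SmoothPeriodic u) :
    sobolevInner k (Aop u) (Aop u) = sobolevInner (k + 2) u u := by
  rw [sobolevInner_Aop_left k hu hu.Aop, sobolevInner_comm, sobolevInner_Aop_left _ hu hu]

theorem sobolevInner_iterate_Aop (k n : ℕ) (hu : SmoothPeriodic u) :
    sobolevInner k (Aop^[n] u) (Aop^[n] u) = sobolevInner (k + 2 * n) u u := by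
  induction n generalizing u with
  | zero => rfl
  | succ n ih =>
    rw [Function.iterate_succ_apply, ih hu.Aop, sobolevInner_Aop_Aop _ hu]
    rfl

theorem sobolevInner_self_log_convex (k : ℕ) (hu : SmoothPeriodic u) :
    sobolevInner (k + 1) u u ^ 2 ≤ sobolevInner k u u * sobolevInner (k + 2) u u := by
  rw [← sobolevInner_Aop_left k hu hu, ← sobolevInner_Aop_Aop k hu, mul_comm]
  exact sobolevInner_sq_le k hu.Aop hu

end Sobolev

/-! ### Interpolation in log-convex sequences -/

section LogConvex

variable {b : ℕ → ℝ}

theorem pow_succ_le_of_log_convex (h0 : ∀ k, 0 ≤ b k)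
    (hb : ∀ k, b (k + 1) ^ 2 ≤ b k * b (k + 2)) (k : ℕ) :
    b k ^ (k + 1) ≤ b 0 * b (k + 1) ^ k := by
  induction k with
  | zero => simp
  | succ k ih =>
    rcases (h0 (k + 1)).eq_or_lt with hz | hp
    · rw [← hz, zero_pow (by omega)]
      exact mul_nonneg (h0 _) (pow_nonneg (h0 _) _)
    · refine le_of_mul_le_mul_left ?_ (pow_pos hp k)
      calc b (k + 1) ^ k * b (k + 1) ^ (k + 1 + 1) = (b (k + 1) ^ 2) ^ (k + 1) := by ring
        _ ≤ (b k * b (k + 2)) ^ (k + 1) := pow_le_pow_left₀ (sq_nonneg _) (hb k) _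
        _ = b k ^ (k + 1) * b (k + 2) ^ (k + 1) := mul_pow _ _ _
        _ ≤ b 0 * b (k + 1) ^ k * b (k + 2) ^ (k + 1) :=
          mul_le_mul_of_nonneg_right ih (pow_nonneg (h0 _) _)
        _ = b (k + 1) ^ k * (b 0 * b (k + 1 + 1) ^ (k + 1)) := by ring

theorem pow_add_le_of_log_convex (h0 : ∀ k, 0 ≤ b k)
    (hb : ∀ k, b (k + 1) ^ 2 ≤ b k * b (k + 2)) (a d : ℕ) :
    b a ^ (a + d) ≤ b 0 ^ d * b (a + d) ^ a := by
  induction d with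
  | zero => simp
  | succ d ih =>
    rcases Nat.eq_zero_or_pos (a + d) with hz | hp
    · obtain ⟨rfl, rfl⟩ : a = 0 ∧ d = 0 := by omega
      simp
    · have hr : 0 ≤ b 0 ^ (d + 1) * b (a + (d + 1)) ^ a :=
        mul_nonneg (pow_nonneg (h0 _) _) (pow_nonneg (h0 _) _)
      refine le_of_pow_le_pow_left₀ hp.ne' hr ?_
      calc (b a ^ (a + (d + 1))) ^ (a + d) = (b a ^ (a + d)) ^ (a + d + 1) := by ring
        _ ≤ (b 0 ^ d * b (a + d) ^ a) ^ (a + d + 1) :=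
          pow_le_pow_left₀ (pow_nonneg (h0 _) _) ih _
        _ = b 0 ^ (d * (a + d + 1)) * (b (a + d) ^ (a + d + 1)) ^ a := by ring
        _ ≤ b 0 ^ (d * (a + d + 1)) * (b 0 * b (a + d + 1) ^ (a + d)) ^ a := by
          refine mul_le_mul_of_nonneg_left ?_ (pow_nonneg (h0 _) _)
          exact pow_le_pow_left₀ (pow_nonneg (h0 _) _) (pow_succ_le_of_log_convex h0 hb _) _
        _ = (b 0 ^ (d + 1) * b (a + (d + 1)) ^ a) ^ (a + d) := by
          rw [← add_assoc]
          ring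

end LogConvex

/-! ### A bilinear Ladyzhenskaya inequality -/

theorem le_integral_add_abs_deriv {g g' : ℝ → ℝ} (hg : ∀ t, HasDerivAt g (g' t) t)
    (hg' : Continuous g') (h0 : ∀ t, 0 ≤ g t) {x : ℝ} (hx : x ∈ Set.Icc 0 (2 * Real.pi)) :
    g x ≤ ∫ t in (0 : ℝ)..(2 * Real.pi), (g t + |g' t|) := by
  have hgc : Continuous g := continuous_iff_continuousAt.2 fun t => (hg t).continuousAt
  have hpi := Real.two_pi_pos
  rw [intervalIntegral.integral_add (hgc.intervalIntegrable _ _)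
    (hg'.abs.intervalIntegrable _ _)]
  set J := ∫ t in (0 : ℝ)..(2 * Real.pi), |g' t|
  have hI : 0 ≤ ∫ t in (0 : ℝ)..(2 * Real.pi), g t :=
    intervalIntegral.integral_nonneg hpi.le fun t _ => h0 t
  have hosc : ∀ t ∈ Set.Icc 0 (2 * Real.pi), g x - J ≤ g t := by
    intro t ht
    have h1 : ∫ s in t..x, g' s = g x - g t :=
      intervalIntegral.integral_eq_sub_of_hasDerivAt (fun s _ => hg s)
        (hg'.intervalIntegrable _ _)
    have h2 : |∫ s in t..x, g' s| ≤ |(∫ s in t..x, |g' s|)| :=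
      by simpa only [Real.norm_eq_abs] using
        intervalIntegral.norm_integral_le_abs_integral_norm (f := g') (a := t) (b := x)
    have h3 : |(∫ s in t..x, |g' s|)| ≤ |J| := by
      refine intervalIntegral.abs_integral_mono_interval ?_
        (Eventually.of_forall fun s => abs_nonneg _) (hg'.abs.intervalIntegrable _ _)
      rw [Set.uIoc_of_le hpi.le]
      exact Set.Ioc_subset_Ioc (le_min ht.1 hx.1) (max_le ht.2 hx.2)
    have h4 : 0 ≤ J := intervalIntegral.integral_nonneg hpi.le fun t _ => abs_nonneg _
    rw [abs_of_nonneg h4] at h3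
    have h5 := le_abs_self (∫ s in t..x, g' s)
    linarith
  have h6 : ∫ _ in (0 : ℝ)..(2 * Real.pi), (g x - J) ≤ ∫ t in (0 : ℝ)..(2 * Real.pi), g t :=
    intervalIntegral.integral_mono_on hpi.le (by simp) (hgc.intervalIntegrable _ _) hosc
  rw [intervalIntegral.integral_const, smul_eq_mul, sub_zero] at h6
  have h7 : 1 ≤ 2 * Real.pi := by linarith [Real.pi_gt_three]
  rcases le_total 0 (g x - J) with h | h
  · nlinarith
  · linarith

/-- The function `f² + |∂ₑ(f²)|`, whose integrals over lines control the supremum of `f²`. -/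
def sqAddAbsPd (e : ℝ × ℝ) (f : ℝ × ℝ → ℝ) : ℝ × ℝ → ℝ :=
  fun p => f p ^ 2 + |2 * f p * pd e f p|

section Ladyzhenskaya

variable {f g : ℝ × ℝ → ℝ}

theorem continuous_sqAddAbsPd (e : ℝ × ℝ) (hf : SmoothPeriodic f) :
    Continuous (sqAddAbsPd e f) := by
  have h1 := hf.continuous
  have h2 := (hf.pd e).continuous
  unfold sqAddAbsPd
  fun_prop

theorem setIntegral_sqAddAbsPd_sq_le {e : ℝ × ℝ} (hf : SmoothPeriodic f)
    (he : l2inner (pd e f) (pd e f) + l2inner f f ≤ sobolevInner 1 f f) :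
    (∫ p in sq2, sqAddAbsPd e f p) ^ 2 ≤ 9 * (sobolevInner 0 f f * sobolevInner 1 f f) := by
  have h1 := hf.continuous
  have h2 := (hf.pd e).continuous
  set q : ℝ × ℝ → ℝ := fun p => |f p| + 2 * |pd e f p| with hq
  have hqc : Continuous q := by fun_prop
  have h3 : ∫ p in sq2, sqAddAbsPd e f p = l2inner (fun p => |f p|) q := by
    refine integral_congr_ae (Eventually.of_forall fun p => ?_)
    simp only [sqAddAbsPd, hq, abs_mul, abs_two, ← sq_abs (f p)]
    ring
  have h4 : l2inner (fun p => |f p|) (fun p => |f p|) = sobolevInner 0 f f := by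
    simp only [sobolevInner, l2inner, abs_mul_abs_self]
  have h5 : l2inner q q ≤ 9 * sobolevInner 1 f f := by
    calc l2inner q q ≤ ∫ p in sq2, 9 * (pd e f p * pd e f p + f p * f p) := by
          refine integral_mono (integrableOn_sq2 (hqc.mul hqc))
            (integrableOn_sq2 (by fun_prop)) fun p => ?_
          simp only [hq]
          rw [← abs_mul_abs_self (pd e f p), ← abs_mul_abs_self (f p)]
          nlinarith [sq_nonneg (|pd e f p| - |f p|), sq_nonneg (|pd e f p|), sq_nonneg (|f p|)]
      _ = 9 * (l2inner (pd e f) (pd e f) + l2inner f f) := by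
          rw [integral_const_mul]
          exact congrArg (9 * ·) (integral_add (integrableOn_sq2 (h2.mul h2))
            (integrableOn_sq2 (h1.mul h1)))
      _ ≤ _ := by linarith
  rw [h3]
  calc _ ≤ _ := l2inner_sq_le h1.abs hqc
    _ ≤ sobolevInner 0 f f * (9 * sobolevInner 1 f f) := by
        rw [h4]
        exact mul_le_mul_of_nonneg_left h5 (sobolevInner_self_nonneg _ _)
    _ = _ := by ring

theorem sq_le_integral_fst (hf : SmoothPeriodic f) {x : ℝ} (hx : x ∈ Set.Icc 0 (2 * Real.pi))
    (y : ℝ) : f (x, y) ^ 2 ≤ ∫ t in (0 : ℝ)..(2 * Real.pi), sqAddAbsPd (1, 0) f (t, y) := by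
  have h1 : Continuous fun t => f (t, y) := hf.continuous.comp (by fun_prop)
  have h2 : Continuous fun t => pd (1, 0) f (t, y) := (hf.pd _).continuous.comp (by fun_prop)
  exact le_integral_add_abs_deriv (g := fun t => f (t, y) ^ 2)
    (g' := fun t => 2 * f (t, y) * pd (1, 0) f (t, y))
    (fun t => by simpa using (hf.hasDerivAt_fst t y).fun_pow 2)
    ((h1.const_mul 2).mul h2)
    (fun t => sq_nonneg _) hx

theorem sq_le_integral_snd (hf : SmoothPeriodic f) {y : ℝ} (hy : y ∈ Set.Icc 0 (2 * Real.pi))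
    (x : ℝ) : f (x, y) ^ 2 ≤ ∫ t in (0 : ℝ)..(2 * Real.pi), sqAddAbsPd (0, 1) f (x, t) := by
  have h1 : Continuous fun t => f (x, t) := hf.continuous.comp (by fun_prop)
  have h2 : Continuous fun t => pd (0, 1) f (x, t) := (hf.pd _).continuous.comp (by fun_prop)
  exact le_integral_add_abs_deriv (g := fun t => f (x, t) ^ 2)
    (g' := fun t => 2 * f (x, t) * pd (0, 1) f (x, t))
    (fun t => by simpa using (hf.hasDerivAt_snd x t).fun_pow 2)
    ((h1.const_mul 2).mul h2)
    (fun t => sq_nonneg _) hy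

theorem l2norm_mul_sq_le (hf : SmoothPeriodic f) (hg : SmoothPeriodic g) :
    l2norm (f * g) ^ 2 ≤
      (∫ p in sq2, sqAddAbsPd (0, 1) f p) * ∫ p in sq2, sqAddAbsPd (1, 0) g p := by
  have hfc := continuous_sqAddAbsPd (0, 1) hf
  have hgc := continuous_sqAddAbsPd (1, 0) hg
  have hF : Continuous fun x => ∫ t in (0 : ℝ)..(2 * Real.pi), sqAddAbsPd (0, 1) f (x, t) :=
    intervalIntegral.continuous_parametric_intervalIntegral_of_continuous' (by fun_prop) _ _
  have hG : Continuous fun y => ∫ t in (0 : ℝ)..(2 * Real.pi), sqAddAbsPd (1, 0) g (t, y) :=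
    intervalIntegral.continuous_parametric_intervalIntegral_of_continuous' (by fun_prop) _ _
  rw [l2norm_sq, setIntegral_sq2_eq hfc, setIntegral_sq2_eq_symm hgc, ← setIntegral_prod_mul]
  refine setIntegral_mono_on (integrableOn_sq2 ((hf.mul hg).mul (hf.mul hg)).continuous)
    (integrableOn_sq2 ((hF.comp continuous_fst).mul (hG.comp continuous_snd)))
    measurableSet_sq2 ?_
  rintro ⟨x, y⟩ ⟨hx, hy⟩
  calc (f * g) (x, y) * (f * g) (x, y) = f (x, y) ^ 2 * g (x, y) ^ 2 := by
        simp only [Pi.mul_apply]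
        ring
    _ ≤ _ := mul_le_mul (sq_le_integral_snd hf hy x) (sq_le_integral_fst hg hx y)
        (sq_nonneg _) ((sq_nonneg _).trans (sq_le_integral_snd hf hy x))

/-- Ladyzhenskaya's inequality for a product of two functions. -/
theorem l2norm_mul_pow_four_le (hf : SmoothPeriodic f) (hg : SmoothPeriodic g) :
    l2norm (f * g) ^ 4 ≤ 81 * (sobolevInner 0 f f * sobolevInner 1 f f *
      (sobolevInner 0 g g * sobolevInner 1 g g)) := by
  have h1 := setIntegral_sqAddAbsPd_sq_le (e := (0, 1)) hf (by
    simp only [sobolevInner]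
    linarith [l2inner_self_nonneg (pd (1, 0) f)])
  have h2 := setIntegral_sqAddAbsPd_sq_le (e := (1, 0)) hg (by
    simp only [sobolevInner]
    linarith [l2inner_self_nonneg (pd (0, 1) g)])
  calc l2norm (f * g) ^ 4 = (l2norm (f * g) ^ 2) ^ 2 := by ring
    _ ≤ _ := pow_le_pow_left₀ (sq_nonneg _) (l2norm_mul_sq_le hf hg) 2
    _ = _ := mul_pow _ _ _
    _ ≤ _ := mul_le_mul h1 h2 (sq_nonneg _) ((sq_nonneg _).trans h1)
    _ = _ := by ring

end Ladyzhenskaya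

/-! ### Products of derivatives -/

/-- `v` behaves like a derivative of `u` of order at most `a`. -/
def DerivLike (u : ℝ × ℝ → ℝ) (a : ℕ) (v : ℝ × ℝ → ℝ) : Prop :=
  SmoothPeriodic v ∧ ∀ k, sobolevInner k v v ≤ sobolevInner (a + k) u u

section DerivLike

variable {u v w : ℝ × ℝ → ℝ} {a b : ℕ}

theorem SmoothPeriodic.derivLike (hu : SmoothPeriodic u) : DerivLike u 0 u :=
  ⟨hu, fun k => by rw [zero_add]⟩

theorem DerivLike.succ (hv : DerivLike u a v) : DerivLike u (a + 1) v :=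
  ⟨hv.1, fun k => (hv.2 k).trans (by
    rw [add_right_comm]
    exact sobolevInner_self_le_succ _ _)⟩

theorem DerivLike.pd_fst (hv : DerivLike u a v) : DerivLike u (a + 1) (pd (1, 0) v) :=
  ⟨hv.1.pd _, fun k => (sobolevInner_pd_fst_le k v).trans (by
    rw [add_assoc, add_comm 1 k]
    exact hv.2 (k + 1))⟩

theorem DerivLike.pd_snd (hv : DerivLike u a v) : DerivLike u (a + 1) (pd (0, 1) v) :=
  ⟨hv.1.pd _, fun k => (sobolevInner_pd_snd_le k v).trans (by
    rw [add_assoc, add_comm 1 k]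
    exact hv.2 (k + 1))⟩

theorem DerivLike.l2norm_mul_pow_le {m : ℕ} (hu : SmoothPeriodic u) (hv : DerivLike u a v)
    (hw : DerivLike u b w) (hab : a + b = 2 * m) :
    l2norm (v * w) ^ (2 * m + 2) ≤ 3 ^ (2 * m + 2) *
      (l2norm u ^ (2 * m + 3) * l2norm (Aop^[m + 1] u) ^ (2 * m + 1)) := by
  set s : ℕ → ℝ := fun k => sobolevInner k u u with hs
  have s0 : ∀ k, 0 ≤ s k := fun k => sobolevInner_self_nonneg k u
  have hY : s 0 = l2norm u ^ 2 := (l2norm_sq u).symm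
  have hX : s (2 * m + 2) = l2norm (Aop^[m + 1] u) ^ 2 := by
    have h := sobolevInner_iterate_Aop 0 (m + 1) hu
    rw [l2norm_sq]
    rw [zero_add] at h
    exact h.symm
  have interp (i d : ℕ) (h : i + d = 2 * m + 2) :
      s i ^ (2 * m + 2) ≤ s 0 ^ d * s (2 * m + 2) ^ i := by
    rw [← h]
    exact pow_add_le_of_log_convex s0 (fun k => sobolevInner_self_log_convex k hu) i d
  have hprod : l2norm (v * w) ^ 4 ≤ 81 * (s a * s (a + 1) * (s b * s (b + 1))) := by
    refine (l2norm_mul_pow_four_le hv.1 hw.1).trans ?_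
    have h1 := hv.2 0
    have h2 := hv.2 1
    have h3 := hw.2 0
    have h4 := hw.2 1
    have n1 := sobolevInner_self_nonneg 0 v
    have n2 := sobolevInner_self_nonneg 1 v
    have n3 := sobolevInner_self_nonneg 0 w
    have n4 := sobolevInner_self_nonneg 1 w
    have := s0 a
    have := s0 (a + 1)
    have := s0 b
    simp only [hs] at *
    rw [add_zero] at h1 h3
    gcongr
  have hR : 0 ≤ 3 ^ (2 * m + 2) *
      (l2norm u ^ (2 * m + 3) * l2norm (Aop^[m + 1] u) ^ (2 * m + 1)) := by
    have := l2norm_nonneg u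
    have := l2norm_nonneg (Aop^[m + 1] u)
    positivity
  refine le_of_pow_le_pow_left₀ (n := 4) (by norm_num) hR ?_
  obtain ⟨da, hda⟩ : ∃ d, a + 1 + d = 2 * m + 2 := ⟨2 * m + 1 - a, by omega⟩
  obtain ⟨db, hdb⟩ : ∃ d, b + 1 + d = 2 * m + 2 := ⟨2 * m + 1 - b, by omega⟩
  have i1 := interp a (da + 1) (by omega)
  have i2 := interp (a + 1) da hda
  have i3 := interp b (db + 1) (by omega)
  have i4 := interp (b + 1) db hdb
  have e1 : da + 1 + da + (db + 1 + db) = 4 * m + 6 := by omega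
  have e2 : a + (a + 1) + (b + (b + 1)) = 4 * m + 2 := by omega
  calc (l2norm (v * w) ^ (2 * m + 2)) ^ 4 = (l2norm (v * w) ^ 4) ^ (2 * m + 2) := by ring
    _ ≤ (81 * (s a * s (a + 1) * (s b * s (b + 1)))) ^ (2 * m + 2) :=
      pow_le_pow_left₀ (pow_nonneg (l2norm_nonneg _) _) hprod _
    _ = 81 ^ (2 * m + 2) * (s a ^ (2 * m + 2) * s (a + 1) ^ (2 * m + 2) *
        (s b ^ (2 * m + 2) * s (b + 1) ^ (2 * m + 2))) := by simp only [mul_pow]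
    _ ≤ 81 ^ (2 * m + 2) * (s 0 ^ (da + 1) * s (2 * m + 2) ^ a *
        (s 0 ^ da * s (2 * m + 2) ^ (a + 1)) *
        (s 0 ^ (db + 1) * s (2 * m + 2) ^ b * (s 0 ^ db * s (2 * m + 2) ^ (b + 1)))) := by
      have := s0 0
      have := s0 a
      have := s0 (a + 1)
      have := s0 b
      have := s0 (b + 1)
      have := s0 (2 * m + 2)
      gcongr
    _ = 81 ^ (2 * m + 2) * (s 0 ^ (da + 1 + da + (db + 1 + db)) *
        s (2 * m + 2) ^ (a + (a + 1) + (b + (b + 1)))) := by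
      simp only [pow_add]
      ring
    _ = _ := by
      rw [e1, e2, hY, hX, show (81 : ℝ) = 3 ^ 4 by norm_num, ← pow_mul, mul_comm 4, pow_mul]
      generalize (3 : ℝ) ^ (2 * m + 2) = t
      ring

theorem DerivLike.l2norm_iterate_Aop_mul_le {n : ℕ} {X R : ℝ} (hX : 0 ≤ X)
    (hR : ∀ (a b : ℕ) (v w : ℝ × ℝ → ℝ), DerivLike u a v → DerivLike u b w → a + b = n →
      X * l2norm (v * w) ≤ R)
    (j : ℕ) (hv : DerivLike u a v) (hw : DerivLike u b w) (hab : a + b + 2 * j = n) :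
    X * l2norm (Aop^[j] (v * w)) ≤ 9 ^ j * R := by
  induction j generalizing a b v w with
  | zero => simpa using hR a b v w hv hw hab
  | succ j ih =>
    have triangle {f g : ℝ × ℝ → ℝ} {c d : ℝ} (hf : SmoothPeriodic f) (hg : SmoothPeriodic g)
        (hc : X * l2norm (Aop^[j] f) ≤ c) (hd : X * l2norm (Aop^[j] g) ≤ d) :
        X * l2norm (Aop^[j] (f + g)) ≤ c + d := by
      rw [hf.iterate_Aop_add hg]
      have h := mul_le_mul_of_nonneg_left
        (l2norm_add_le (hf.iterate_Aop j).continuous (hg.iterate_Aop j).continuous) hX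
      linarith
    have scale {f : ℝ × ℝ → ℝ} {c : ℝ} (r : ℝ) (hf : SmoothPeriodic f)
        (hc : X * l2norm (Aop^[j] f) ≤ c) : X * l2norm (Aop^[j] (r • f)) ≤ |r| * c := by
      rw [hf.iterate_Aop_smul, l2norm_smul, mul_left_comm]
      exact mul_le_mul_of_nonneg_left hc (abs_nonneg r)
    have t1 := ih hv.pd_fst.pd_fst hw (by omega)
    have t2 := ih hv hw.pd_fst.pd_fst (by omega)
    have t3 := ih hv.pd_fst hw.pd_fst (by omega)
    have t4 := ih hv.pd_snd.pd_snd hw (by omega)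
    have t5 := ih hv hw.pd_snd.pd_snd (by omega)
    have t6 := ih hv.pd_snd hw.pd_snd (by omega)
    have t7 := ih hv.succ hw.succ (by omega)
    have s1 := hv.pd_fst.pd_fst.1.mul hw.1
    have s2 := hv.1.mul hw.pd_fst.pd_fst.1
    have s3 := hv.pd_fst.1.mul hw.pd_fst.1
    have s4 := hv.pd_snd.pd_snd.1.mul hw.1
    have s5 := hv.1.mul hw.pd_snd.pd_snd.1
    have s6 := hv.pd_snd.1.mul hw.pd_snd.1
    have s12 := (s1.smul (-1)).add (s2.smul (-1))
    have s13 := s12.add (s3.smul (-2))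
    have s14 := s13.add (s4.smul (-1))
    have s15 := s14.add (s5.smul (-1))
    have s16 := s15.add (s6.smul (-2))
    rw [Function.iterate_succ_apply, hv.1.Aop_mul hw.1]
    refine (triangle s16 (hv.1.mul hw.1) (triangle s15 (s6.smul _) (triangle s14 (s5.smul _)
      (triangle s13 (s4.smul _) (triangle s12 (s3.smul _) (triangle (s1.smul _) (s2.smul _)
      (scale _ s1 t1) (scale _ s2 t2)) (scale _ s3 t3)) (scale _ s4 t4)) (scale _ s5 t5))
      (scale _ s6 t6)) t7).trans_eq ?_
    norm_num
    ring

end DerivLike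

/-- A form of Young's inequality. -/
theorem mul_le_of_pow_le_mul_pow {n : ℕ} {X N K Z δ : ℝ} (hX : 0 ≤ X) (hN : 0 ≤ N) (hK : 0 ≤ K)
    (hZ : 0 ≤ Z) (hδ : 0 < δ) (h : N ^ (n + 1) ≤ K * (Z * X ^ n)) :
    X * N ≤ δ * X ^ 2 + (K / δ ^ n) ^ 2 / δ * Z ^ 2 := by
  rcases le_or_gt N (δ * X) with h1 | h1
  · have : 0 ≤ (K / δ ^ n) ^ 2 / δ * Z ^ 2 := by positivity
    nlinarith
  · have hNp : 0 < N := (mul_nonneg hδ.le hX).trans_lt h1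
    have h2 : X ≤ N / δ := by
      rw [le_div_iff₀ hδ]
      linarith
    have h3 : N ≤ K / δ ^ n * Z := by
      refine le_of_mul_le_mul_left ?_ (pow_pos hNp n)
      calc N ^ n * N = N ^ (n + 1) := (pow_succ N n).symm
        _ ≤ K * (Z * X ^ n) := h
        _ ≤ K * (Z * (N / δ) ^ n) := by gcongr
        _ = N ^ n * (K / δ ^ n * Z) := by
          rw [div_pow]
          ring
    calc X * N ≤ N / δ * N := mul_le_mul_of_nonneg_right h2 hN
      _ = N ^ 2 / δ := by ring
      _ ≤ (K / δ ^ n * Z) ^ 2 / δ := by gcongr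
      _ = (K / δ ^ n) ^ 2 / δ * Z ^ 2 := by ring
      _ ≤ _ := le_add_of_nonneg_left (by positivity)

/-- Estimate for `‖A^{m+1}u‖ ‖A^{m−1}(|∇u|²)‖`. -/
theorem stmt_5 (m : ℕ) (hm : 1 ≤ m) :
    ∀ ε > (0 : ℝ), ∃ c > 0, ∀ u : ℝ × ℝ → ℝ, SmoothPeriodic u →
      l2norm (Aop^[m + 1] u) * l2norm (Aop^[m - 1] (gradDot u u)) ≤
        ε * l2norm (Aop^[m + 1] u) ^ 2 + c * (l2norm u ^ (2 * (2 * m + 3)) + 1) := by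
  intro ε hε
  set δ : ℝ := ε / (2 * 9 ^ (m - 1)) with hδ
  have hδ0 : 0 < δ := by positivity
  set κ : ℝ := (3 ^ (2 * m + 2) / δ ^ (2 * m + 1)) ^ 2 / δ with hκ
  have hκ0 : 0 < κ := by positivity
  refine ⟨2 * (9 ^ (m - 1) * κ), by positivity, fun u hu => ?_⟩
  set X := l2norm (Aop^[m + 1] u) with hX
  set Y := l2norm u with hY
  have hX0 : 0 ≤ X := l2norm_nonneg _
  have hY0 : 0 ≤ Y := l2norm_nonneg _
  set R : ℝ := δ * X ^ 2 + κ * (Y ^ (2 * m + 3)) ^ 2 with hR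
  have hprod : ∀ (a b : ℕ) (v w : ℝ × ℝ → ℝ), DerivLike u a v → DerivLike u b w →
      a + b = 2 * m → X * l2norm (v * w) ≤ R := fun a b v w hv hw hab =>
    mul_le_of_pow_le_mul_pow (n := 2 * m + 1) hX0 (l2norm_nonneg _) (by positivity)
      (pow_nonneg hY0 _) hδ0 (hv.l2norm_mul_pow_le hu hw hab)
  have hx := hu.derivLike.pd_fst
  have hy := hu.derivLike.pd_snd
  have bx := DerivLike.l2norm_iterate_Aop_mul_le hX0 hprod (m - 1) hx hx (by omega)
  have bY := DerivLike.l2norm_iterate_Aop_mul_le hX0 hprod (m - 1) hy hy (by omega)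
  have hxx := hx.1.mul hx.1
  have hyy := hy.1.mul hy.1
  have hgrad : gradDot u u = pd (1, 0) u * pd (1, 0) u + pd (0, 1) u * pd (0, 1) u := rfl
  have hε' : 2 * (9 ^ (m - 1) * δ) = ε := by
    rw [hδ]
    field_simp
  calc X * l2norm (Aop^[m - 1] (gradDot u u))
      ≤ X * (l2norm (Aop^[m - 1] (pd (1, 0) u * pd (1, 0) u)) +
        l2norm (Aop^[m - 1] (pd (0, 1) u * pd (0, 1) u))) := by
        rw [hgrad, hxx.iterate_Aop_add hyy]
        exact mul_le_mul_of_nonneg_left (l2norm_add_le (hxx.iterate_Aop _).continuous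
          (hyy.iterate_Aop _).continuous) hX0
    _ ≤ 2 * (9 ^ (m - 1) * R) := by linarith
    _ = 2 * (9 ^ (m - 1) * δ) * X ^ 2 +
        2 * (9 ^ (m - 1) * κ) * Y ^ (2 * (2 * m + 3)) := by
        rw [hR, ← pow_mul, mul_comm (2 * m + 3) 2]
        ring
    _ ≤ _ := by
        rw [hε']
        gcongr
        exact le_add_of_nonneg_right zero_le_one
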